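/- Let F = K_{a_1,…,a_r} be a complete multipartite graph with part sizes a_1 ≥ … ≥ a_r ≥ 1, r ≥ 2, and suppose a_{r−1} ≥ 2 (i.e., at most one part is a singleton). Then there exists an integer t ≥ r such that for every k > t, i_k(F) = i_{t+1}(F); consequently i(F) = i_{t+1}(F) = max_{x ∈ Δ^{t−1}} P_{F,t}(x), and F is not inducibility diverse. -/

import Mathlib

open Filter Topology

/-- The number of `|V(F)|`-element subsets of the vertex set of `G` that induce a
subgraph isomorphic to `F`. -/
noncomputable def inducedCount {α β : Type*} [Fintype α] [Fintype β]
    (F : SimpleGraph α) (G : SimpleGraph β) : ℕ :=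
  Set.ncard {s : Finset β | s.card = Fintype.card α ∧
    Nonempty (F ≃g SimpleGraph.induce (↑s : Set β) G)}

/-- The induced density `p(F,G) = P(F,G)/C(n,r)`. -/
noncomputable def inducedDensity {α β : Type*} [Fintype α] [Fintype β]
    (F : SimpleGraph α) (G : SimpleGraph β) : ℝ :=
  (inducedCount F G : ℝ) / ((Fintype.card β).choose (Fintype.card α))

/-- `i_k(F,n)`: the maximum induced density of `F` over `K_k`-free graphs on `n` vertices. -/
noncomputable def ikn {α : Type*} [Fintype α] (F : SimpleGraph α) (k n : ℕ) : ℝ :=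
  sSup {x : ℝ | ∃ G : SimpleGraph (Fin n), G.CliqueFree k ∧ x = inducedDensity F G}

/-- `i_k(F) = lim_{n → ∞} i_k(F,n)`. -/
noncomputable def ik {α : Type*} [Fintype α] (F : SimpleGraph α) (k : ℕ) : ℝ :=
  limUnder atTop (fun n => ikn F k n)

/-- A graph `F` is inducibility diverse if for every `k` there is `m > k`
with `i_k(F) < i_m(F)`. -/
def InducibilityDiverse {α : Type*} [Fintype α] (F : SimpleGraph α) : Prop :=
  ∀ k : ℕ, ∃ m : ℕ, k < m ∧ ik F k < ik F m

/-- `i(F,n)`: the maximum induced density of `F` over all graphs on `n` vertices. -/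
noncomputable def iN {α : Type*} [Fintype α] (F : SimpleGraph α) (n : ℕ) : ℝ :=
  sSup {x : ℝ | ∃ G : SimpleGraph (Fin n), x = inducedDensity F G}

/-- The inducibility `i(F) = lim_{n → ∞} i(F,n)`. -/
noncomputable def inducibility {α : Type*} [Fintype α] (F : SimpleGraph α) : ℝ :=
  limUnder atTop (fun n => iN F n)

/-- The density polynomial `P_{F,m}` of the complete multipartite graph with part sizes
`a_1, …, a_r`, in `m` variables:
`(s!/(a_1!⋯a_r!·π(F))) · Σ_σ ∏_i x_{σ(i)}^{a_i}`, summed over injections `σ : [r] → [m]`,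
where `π(F) = ∏_n c(n)!` and `c(n)` is the number of parts of size `n`. -/
noncomputable def PF {r : ℕ} (a : Fin r → ℕ) (m : ℕ) (x : Fin m → ℝ) : ℝ :=
  (((∑ i, a i).factorial : ℝ) /
      (((∏ i, (a i).factorial) *
        ∏ n ∈ Finset.range ((∑ i, a i) + 1),
          ((Finset.univ.filter fun i => a i = n).card.factorial) : ℕ) : ℝ)) *
    ∑ σ : Fin r ↪ Fin m, ∏ i, x (σ i) ^ a i

/-- The weight that `w` becomes when `p` absorbs the weight of `q`. -/
def mergeWeight {V : Type*} [DecidableEq V] (w : V → ℝ) (p q : V) : V → ℝ :=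
  Function.update (Function.update w p (w p + w q)) q 0

section mergeWeight

variable {V : Type*} [DecidableEq V] {w : V → ℝ} {p q : V}

lemma mergeWeight_right : mergeWeight w p q q = 0 := by simp [mergeWeight]

lemma mergeWeight_left (hpq : p ≠ q) : mergeWeight w p q p = w p + w q := by
  simp [mergeWeight, hpq]

lemma mergeWeight_of_ne {v : V} (hp : v ≠ p) (hq : v ≠ q) : mergeWeight w p q v = w v := by
  simp [mergeWeight, hp, hq]

lemma mergeWeight_swap (hpq : p ≠ q) (v : V) :
    mergeWeight w q p (Equiv.swap p q v) = mergeWeight w p q v := by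
  rcases eq_or_ne v p with rfl | hp
  · rw [Equiv.swap_apply_left, mergeWeight_left hpq.symm, mergeWeight_left hpq, add_comm]
  rcases eq_or_ne v q with rfl | hq
  · rw [Equiv.swap_apply_right, mergeWeight_right, mergeWeight_right]
  rw [Equiv.swap_apply_of_ne_of_ne hp hq, mergeWeight_of_ne hq hp, mergeWeight_of_ne hp hq]

lemma mergeWeight_nonneg (hw : ∀ v, 0 ≤ w v) (hpq : p ≠ q) (v : V) : 0 ≤ mergeWeight w p q v := by
  rcases eq_or_ne v q with rfl | hq
  · rw [mergeWeight_right]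
  rcases eq_or_ne v p with rfl | hp
  · rw [mergeWeight_left hpq]; exact add_nonneg (hw _) (hw _)
  · rw [mergeWeight_of_ne hp hq]; exact hw v

lemma le_mergeWeight (hw : ∀ v, 0 ≤ w v) (hpq : p ≠ q) {v : V} (hq : v ≠ q) :
    w v ≤ mergeWeight w p q v := by
  rcases eq_or_ne v p with rfl | hp
  · rw [mergeWeight_left hpq]; linarith [hw q]
  · rw [mergeWeight_of_ne hp hq]

lemma mergeWeight_eq_sum [Fintype V] (hpq : p ≠ q) (z : V) :
    mergeWeight w p q z = ∑ v with Function.update id q p v = z, w v := by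
  rcases eq_or_ne z q with rfl | hq
  · rw [mergeWeight_right, Finset.sum_eq_zero]
    intro v hv
    simp only [Finset.mem_filter, Finset.mem_univ, true_and, Function.update_apply, id] at hv
    split_ifs at hv with h
    · exact absurd hv hpq
    · exact absurd hv h
  rcases eq_or_ne z p with rfl | hp
  · rw [mergeWeight_left hpq, ← Finset.sum_pair hpq]
    congr 1
    ext v
    simp only [Finset.mem_filter, Finset.mem_univ, true_and, Function.update_apply, id,
      Finset.mem_insert, Finset.mem_singleton]
    grind
  · rw [mergeWeight_of_ne hp hq, ← Finset.sum_singleton w z]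
    congr 1
    ext v
    simp only [Finset.mem_filter, Finset.mem_univ, true_and, Function.update_apply, id,
      Finset.mem_singleton]
    grind

lemma mergeWeight_mem_stdSimplex [Fintype V] (hw : w ∈ stdSimplex ℝ V) (hpq : p ≠ q) :
    mergeWeight w p q ∈ stdSimplex ℝ V := by
  refine ⟨mergeWeight_nonneg hw.1 hpq, ?_⟩
  simp_rw [mergeWeight_eq_sum hpq]
  rw [Finset.sum_fiberwise, hw.2]

lemma card_support_mergeWeight_lt [Fintype V] (hpq : p ≠ q) (hp : w p ≠ 0) (hq : w q ≠ 0) :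
    (Finset.univ.filter fun v => mergeWeight w p q v ≠ 0).card <
      (Finset.univ.filter fun v => w v ≠ 0).card := by
  apply Finset.card_lt_card
  rw [Finset.ssubset_iff_of_subset]
  · exact ⟨q, by simpa using hq, by simp [mergeWeight_right]⟩
  · intro v
    simp only [Finset.mem_filter, Finset.mem_univ, true_and]
    intro h
    have hvq : v ≠ q := by rintro rfl; exact h mergeWeight_right
    rcases eq_or_ne v p with rfl | hvp
    · exact hp
    · rwa [mergeWeight_of_ne hvp hvq] at h

end mergeWeight

/-- Summing a product weight over the maps lying above `f` gives the product of the pushed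
forward weights. -/
lemma sum_prod_filter_comp_eq {U V V' : Type*} [Fintype U] [DecidableEq U] [Fintype V]
    [DecidableEq V'] (φ : V → V') (w : V → ℝ) (f : U → V') :
    ∑ g : U → V with φ ∘ g = f, ∏ u, w (g u) = ∏ u, ∑ v with φ v = f u, w v := by
  rw [Finset.prod_univ_sum]
  refine Finset.sum_congr ?_ fun _ _ => rfl
  ext g
  simp [funext_iff]

open Classical in
/-- The weighted sum over all maps `f` from the vertices of `F` to those of `G` under which `F` is
the pullback of `G`. -/
noncomputable def patternSum {U V : Type*} [Fintype U] [Fintype V] (F : SimpleGraph U)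
    (G : SimpleGraph V) (w : V → ℝ) : ℝ :=
  ∑ f : U → V, if G.comap f = F then ∏ u, w (f u) else 0

section Symmetrization

variable {U V : Type*} [Fintype U] [Fintype V] {F : SimpleGraph U} {G : SimpleGraph V}
  {w : V → ℝ} {p q : V}

omit [Fintype U] [Fintype V] in
lemma comap_eq_of_update_comp_eq [DecidableEq V] (hF : F.IsCompleteMultipartite)
    (hadj : ¬ G.Adj p q) {g f : U → V} (hg : G.comap g = F) (hgf : Function.update id q p ∘ g = f)
    (hp : ∃ u, g u = p) (hq : ∃ u, g u = q) :
    G.comap f = F ∧ G.comap (Equiv.swap p q ∘ f) = F := by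
  obtain ⟨u₁, h₁⟩ := hp
  obtain ⟨u₂, h₂⟩ := hq
  have hadj' : ¬ G.Adj q p := fun h => hadj h.symm
  have hgA : ∀ u v, F.Adj u v ↔ G.Adj (g u) (g v) := by intro u v; rw [← hg]; rfl
  have htr : ∀ u v x, ¬ F.Adj u v → (F.Adj u x ↔ F.Adj v x) := by
    intro u v x h
    constructor
    · intro h1
      by_contra h2
      exact (hF.trans u v x h h2) h1
    · intro h1
      by_contra h2
      exact (hF.trans v u x (fun h' => h h'.symm) h2) h1
  have h12 : ¬ F.Adj u₁ u₂ := by rw [hgA, h₁, h₂]; exact hadj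
  have key : ∀ x, F.Adj u₁ x ↔ F.Adj u₂ x := fun x => htr _ _ x h12
  have key' : ∀ x, G.Adj p (g x) ↔ G.Adj q (g x) := by
    intro x
    have := key x
    rwa [hgA, hgA, h₁, h₂] at this
  have key'' : ∀ x, G.Adj (g x) p ↔ G.Adj (g x) q := by
    intro x
    rw [G.adj_comm, key', G.adj_comm]
  have hf : ∀ u, f u = if g u = q then p else g u := by
    intro u; rw [← hgf]; simp [Function.update_apply]
  have hsf : ∀ u, Equiv.swap p q (f u) = if g u = p then q else g u := by
    intro u
    rw [hf]
    split_ifs with h1 h2 h2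
    · simp
    · simp [h1]
    · simp [h2]
    · exact Equiv.swap_apply_of_ne_of_ne h2 h1
  have hpp : ¬ G.Adj p p := G.loopless.irrefl p
  have hqq : ¬ G.Adj q q := G.loopless.irrefl q
  constructor
  · ext u v
    rw [hgA, SimpleGraph.comap_adj, hf, hf]
    have h1 := key' u
    have h2 := key' v
    have h3 := key'' u
    have h4 := key'' v
    split_ifs with h h' h' <;> simp_all
  · ext u v
    rw [hgA, SimpleGraph.comap_adj, Function.comp, Function.comp, hsf, hsf]
    have h1 := key' u
    have h2 := key' v
    have h3 := key'' u
    have h4 := key'' v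
    split_ifs with h h' h' <;> simp_all

omit [Fintype V] in
lemma mul_prod_le_mul_prod_mergeWeight [DecidableEq V] (hw : ∀ v, 0 ≤ w v) (hpq : p ≠ q)
    {f : U → V} {u : U} (hu : f u = p) (hf : ∀ u, f u ≠ q) :
    (w p + w q) * ∏ u, w (f u) ≤ w p * ∏ u, mergeWeight w p q (f u) := by
  classical
  rw [← Finset.mul_prod_erase _ _ (Finset.mem_univ u),
    ← Finset.mul_prod_erase _ (fun u => mergeWeight w p q (f u)) (Finset.mem_univ u), hu,
    mergeWeight_left hpq]
  have : ∏ x ∈ Finset.univ.erase u, w (f x) ≤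
      ∏ x ∈ Finset.univ.erase u, mergeWeight w p q (f x) :=
    Finset.prod_le_prod (fun _ _ => hw _) fun x _ => le_mergeWeight hw hpq (hf x)
  have h0 : 0 ≤ (w p + w q) * w p := mul_nonneg (add_nonneg (hw p) (hw q)) (hw p)
  nlinarith [mul_le_mul_of_nonneg_left this h0]

open Classical in
lemma mul_fiber_sum_le (hF : F.IsCompleteMultipartite) (hpq : p ≠ q)
    (hadj : ¬ G.Adj p q) (hw : ∀ v, 0 ≤ w v) (f : U → V) :
    (w p + w q) * (∑ g : U → V with Function.update id q p ∘ g = f,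
        if G.comap g = F then ∏ u, w (g u) else 0) ≤
      w p * (if G.comap f = F then ∏ u, mergeWeight w p q (f u) else 0) +
      w q * (if G.comap (Equiv.swap p q ∘ f) = F then ∏ u, mergeWeight w p q (f u) else 0) := by
  have hM : ∀ f : U → V, 0 ≤ ∏ u, mergeWeight w p q (f u) :=
    fun f => Finset.prod_nonneg fun u _ => mergeWeight_nonneg hw hpq _
  have hW : ∀ f : U → V, 0 ≤ ∏ u, w (f u) := fun f => Finset.prod_nonneg fun u _ => hw _
  have hc : 0 ≤ w p + w q := add_nonneg (hw p) (hw q)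
  by_cases hmix : ∃ g : U → V, Function.update id q p ∘ g = f ∧ G.comap g = F ∧
      (∃ u, g u = p) ∧ (∃ u, g u = q)
  · obtain ⟨g, hgf, hg, hp, hq⟩ := hmix
    obtain ⟨h1, h2⟩ := comap_eq_of_update_comp_eq hF hadj hg hgf hp hq
    rw [if_pos h1, if_pos h2, ← add_mul]
    refine mul_le_mul_of_nonneg_left ?_ hc
    calc _ ≤ ∑ g : U → V with Function.update id q p ∘ g = f, ∏ u, w (g u) :=
          Finset.sum_le_sum fun g _ => by split_ifs <;> simp [hW]
      _ = _ := by
          rw [sum_prod_filter_comp_eq]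
          simp_rw [mergeWeight_eq_sum hpq]
  · by_cases hfq : ∃ u, f u = q
    · rw [Finset.sum_eq_zero, mul_zero]
      · exact add_nonneg (mul_nonneg (hw p) (by split_ifs <;> simp [hM]))
          (mul_nonneg (hw q) (by split_ifs <;> simp [hM]))
      · intro g hg
        obtain ⟨u, hu⟩ := hfq
        have := congrFun (Finset.mem_filter.1 hg).2 u
        simp only [Function.comp, Function.update_apply, id, hu] at this
        grind
    push Not at hfq
    have hsub : ∀ g : U → V, Function.update id q p ∘ g = f → G.comap g = F →
        g = f ∨ g = Equiv.swap p q ∘ f := by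
      intro g hgf hg
      have hgf' : ∀ u, f u = if g u = q then p else g u := by
        intro u; rw [← hgf]; simp [Function.update_apply]
      by_cases h1 : ∃ u, g u = q
      · have h2 : ∀ u, g u ≠ p := by
          intro u hu
          exact hmix ⟨g, hgf, hg, ⟨u, hu⟩, h1⟩
        right
        ext u
        rw [Function.comp, hgf']
        split_ifs with h
        · simp [h]
        · rw [Equiv.swap_apply_of_ne_of_ne (h2 u) h]
      · left
        push Not at h1
        ext u
        rw [hgf', if_neg (h1 u)]
    by_cases hfp : ∃ u, f u = p
    · obtain ⟨u, hu⟩ := hfp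
      have hne : f ≠ Equiv.swap p q ∘ f := by
        intro h
        have := congrFun h u
        simp only [Function.comp, hu, Equiv.swap_apply_left] at this
        exact hpq this
      have hle : (∑ g : U → V with Function.update id q p ∘ g = f,
          if G.comap g = F then ∏ u, w (g u) else 0) ≤
          ∑ g ∈ ({f, Equiv.swap p q ∘ f} : Finset (U → V)),
            if G.comap g = F then ∏ u, w (g u) else 0 := by
        rw [← Finset.sum_filter, ← Finset.sum_filter]
        refine Finset.sum_le_sum_of_subset_of_nonneg ?_ fun g _ _ => hW g
        intro g hg
        simp only [Finset.mem_filter, Finset.mem_univ, true_and, Finset.mem_insert,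
          Finset.mem_singleton] at hg ⊢
        exact ⟨hsub g hg.1 hg.2, hg.2⟩
      rw [Finset.sum_pair hne] at hle
      refine (mul_le_mul_of_nonneg_left hle hc).trans ?_
      rw [mul_add]
      have hA := mul_prod_le_mul_prod_mergeWeight hw hpq hu hfq
      have hB := mul_prod_le_mul_prod_mergeWeight (p := q) (q := p) (f := Equiv.swap p q ∘ f)
        (u := u) hw hpq.symm (by simp [hu]) (by
          intro v hv
          have : f v = q := by
            have := congrArg (Equiv.swap p q) hv
            simpa using this
          exact hfq v this)
      simp only [Function.comp_apply, mergeWeight_swap hpq] at hB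
      refine add_le_add ?_ ?_
      · split_ifs
        · exact hA
        · simp
      · split_ifs
        · simp only [Function.comp_apply]; rw [add_comm]; exact hB
        · simp
    · push Not at hfp
      have hswap : Equiv.swap p q ∘ f = f := by
        ext u
        exact Equiv.swap_apply_of_ne_of_ne (hfp u) (hfq u)
      have hprod : ∏ u, mergeWeight w p q (f u) = ∏ u, w (f u) :=
        Finset.prod_congr rfl fun u _ => mergeWeight_of_ne (hfp u) (hfq u)
      rw [hswap, ← add_mul, hprod]
      refine mul_le_mul_of_nonneg_left ?_ hc
      calc _ ≤ ∑ g ∈ ({f} : Finset (U → V)), if G.comap g = F then ∏ u, w (g u) else 0 := by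
            rw [← Finset.sum_filter, ← Finset.sum_filter]
            refine Finset.sum_le_sum_of_subset_of_nonneg ?_ fun g _ _ => hW g
            intro g hg
            simp only [Finset.mem_filter, Finset.mem_univ, true_and,
              Finset.mem_singleton] at hg ⊢
            have := hsub g hg.1 hg.2
            rw [hswap, or_self] at this
            exact ⟨this, hg.2⟩
        _ = _ := by simp

open Classical in
/-- Zykov symmetrization for weights: the pattern sum is at most the weighted average of
the pattern sums in which one of two nonadjacent vertices has absorbed the other. -/
lemma mul_patternSum_le (hF : F.IsCompleteMultipartite) (hpq : p ≠ q)
    (hadj : ¬ G.Adj p q) (hw : ∀ v, 0 ≤ w v) :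
    (w p + w q) * patternSum F G w ≤
      w p * patternSum F G (mergeWeight w p q) + w q * patternSum F G (mergeWeight w q p) := by
  have hq : patternSum F G (mergeWeight w q p) = ∑ f : U → V,
      if G.comap (Equiv.swap p q ∘ f) = F then ∏ u, mergeWeight w p q (f u) else 0 := by
    rw [patternSum, ← Equiv.sum_comp (Equiv.arrowCongr (Equiv.refl U) (Equiv.swap p q))]
    refine Finset.sum_congr rfl fun f _ => ?_
    have : (Equiv.arrowCongr (Equiv.refl U) (Equiv.swap p q)) f = Equiv.swap p q ∘ f := rfl
    rw [this]
    simp only [Function.comp_apply]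
    simp_rw [mergeWeight_swap hpq]
  rw [hq, patternSum, patternSum,
    ← Finset.sum_fiberwise Finset.univ (fun g : U → V => Function.update id q p ∘ g),
    Finset.mul_sum, Finset.mul_sum, Finset.mul_sum, ← Finset.sum_add_distrib]
  refine Finset.sum_le_sum fun f _ => ?_
  refine le_of_eq_of_le ?_ (mul_fiber_sum_le hF hpq hadj hw f)
  congr!

lemma patternSum_eq_top_of_forall_adj (h : ∀ p q, p ≠ q → w p ≠ 0 → w q ≠ 0 → G.Adj p q) :
    patternSum F G w = patternSum F ⊤ w := by
  classical
  refine Finset.sum_congr rfl fun f _ => ?_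
  by_cases h0 : ∃ u, w (f u) = 0
  · obtain ⟨u, hu⟩ := h0
    rw [Finset.prod_eq_zero (Finset.mem_univ u) hu, ite_self, ite_self]
  · push Not at h0
    have : G.comap f = (⊤ : SimpleGraph V).comap f := by
      ext u v
      simp only [SimpleGraph.comap_adj, SimpleGraph.top_adj]
      exact ⟨fun h => h.ne, fun hne => h _ _ hne (h0 u) (h0 v)⟩
    rw [this]

/-- Every pattern sum of a complete multipartite graph is at most one over a complete graph. -/
lemma exists_patternSum_le_top (hF : F.IsCompleteMultipartite) (G : SimpleGraph V)
    (hw : w ∈ stdSimplex ℝ V) :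
    ∃ w' ∈ stdSimplex ℝ V, patternSum F G w ≤ patternSum F ⊤ w' := by
  classical
  induction hn : (Finset.univ.filter fun v => w v ≠ 0).card using Nat.strong_induction_on
    generalizing w with
  | _ n ih =>
  by_cases h : ∀ p q, p ≠ q → w p ≠ 0 → w q ≠ 0 → G.Adj p q
  · exact ⟨w, hw, (patternSum_eq_top_of_forall_adj h).le⟩
  push Not at h
  obtain ⟨p, q, hpq, hp, hq, hadj⟩ := h
  have key := mul_patternSum_le hF hpq hadj hw.1
  have hp0 : 0 < w p := (hw.1 p).lt_of_ne hp.symm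
  have hq0 : 0 < w q := (hw.1 q).lt_of_ne hq.symm
  have : patternSum F G w ≤ patternSum F G (mergeWeight w p q) ∨
      patternSum F G w ≤ patternSum F G (mergeWeight w q p) := by
    by_contra! hcon
    nlinarith [mul_lt_mul_of_pos_left hcon.1 hp0, mul_lt_mul_of_pos_left hcon.2 hq0]
  rcases this with h | h
  · obtain ⟨w', hw', hle⟩ := ih _ (hn ▸ card_support_mergeWeight_lt hpq hp hq)
      (mergeWeight_mem_stdSimplex hw hpq) rfl
    exact ⟨w', hw', h.trans hle⟩
  · obtain ⟨w', hw', hle⟩ := ih _ (hn ▸ card_support_mergeWeight_lt hpq.symm hq hp)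
      (mergeWeight_mem_stdSimplex hw hpq.symm) rfl
    exact ⟨w', hw', h.trans hle⟩

end Symmetrization

lemma sum_le_sum_of_injOn_of_le {α β : Type*} {s : Finset α} {t : Finset β} {f : α → ℝ}
    {g : β → ℝ} (e : α → β) (hst : ∀ x ∈ s, e x ∈ t) (he : Set.InjOn e s)
    (hfg : ∀ x ∈ s, f x ≤ g (e x)) (hg : ∀ y ∈ t, 0 ≤ g y) :
    ∑ x ∈ s, f x ≤ ∑ y ∈ t, g y := by
  classical
  calc ∑ x ∈ s, f x ≤ ∑ x ∈ s, g (e x) := Finset.sum_le_sum hfg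
    _ = ∑ y ∈ s.image e, g y := (Finset.sum_image he).symm
    _ ≤ _ := Finset.sum_le_sum_of_subset_of_nonneg (Finset.image_subset_iff.2 hst)
      fun y hy _ => hg y hy

lemma sum_le_sum_sum_of_cover {α β : Type*} {s t : Finset α} {I : Finset β} {f : α → ℝ}
    (R : β → α → Prop) [∀ b, DecidablePred (R b)] (hst : s ⊆ t) (hf : ∀ x ∈ t, 0 ≤ f x)
    (h : ∀ x ∈ s, ∃ b ∈ I, R b x) :
    ∑ x ∈ s, f x ≤ ∑ b ∈ I, ∑ x ∈ t with R b x, f x := by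
  simp_rw [Finset.sum_filter]
  rw [Finset.sum_comm]
  refine (Finset.sum_le_sum fun x hx => ?_).trans
    (Finset.sum_le_sum_of_subset_of_nonneg hst fun x hx _ =>
      Finset.sum_nonneg fun b _ => ?_)
  · obtain ⟨b, hb, hR⟩ := h x hx
    calc f x = if R b x then f x else 0 := (if_pos hR).symm
      _ ≤ _ := Finset.single_le_sum (f := fun b => if R b x then f x else 0)
        (fun b _ => by split_ifs <;> simp [hf x (hst hx)]) hb
  · split_ifs <;> simp [hf x hx]

/-- The sum over injections `σ` of the monomials `∏ i, w (σ i) ^ a i`. -/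
noncomputable def injSum {ι V : Type*} [Fintype ι] [DecidableEq ι] [Fintype V]
    [DecidableEq V] (a : ι → ℕ)
    (w : V → ℝ) : ℝ :=
  ∑ σ : ι → V with Function.Injective σ, ∏ i, w (σ i) ^ a i

section InjSum

variable {ι V : Type*} [Fintype ι] [DecidableEq ι] [Fintype V] [DecidableEq V] {a : ι → ℕ}
  {w : V → ℝ} {p q : V}

omit [Fintype ι] [DecidableEq ι] [DecidableEq V] in
lemma sum_pow_le_one (hw : w ∈ stdSimplex ℝ V) (ha : ∀ i, 1 ≤ a i) (i : ι) :
    ∑ v, w v ^ a i ≤ 1 := by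
  rw [← hw.2]
  refine Finset.sum_le_sum fun v _ => ?_
  exact pow_le_of_le_one (hw.1 v) ((mem_Icc_of_mem_stdSimplex hw v).2)
      (Nat.one_le_iff_ne_zero.1 (ha i))

lemma sum_prod_pow_le (hw : w ∈ stdSimplex ℝ V) (ha : ∀ i, 1 ≤ a i) (i : ι) (p : V) :
    ∑ σ : ι → V with σ i = p, ∏ l, w (σ l) ^ a l ≤ w p ^ a i := by
  let S : ι → Finset V := fun l => if l = i then {p} else Finset.univ
  have hS : (Finset.univ.filter fun σ : ι → V => σ i = p) = Fintype.piFinset S := by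
    ext σ
    simp only [Finset.mem_filter, Finset.mem_univ, true_and, Fintype.mem_piFinset, S]
    constructor
    · intro h l
      split_ifs with hl <;> simp [*]
    · intro h
      simpa using h i
  rw [hS, ← Finset.prod_univ_sum S (fun l v => w v ^ a l)]
  calc _ ≤ ∏ l, if l = i then w p ^ a i else 1 := by
        refine Finset.prod_le_prod
          (fun l _ => Finset.sum_nonneg fun v _ => pow_nonneg (hw.1 v) _) fun l _ => ?_
        by_cases hl : l = i
        · simp [S, hl]
        · simpa [S, hl] using sum_pow_le_one hw ha l
    _ = _ := by simp

lemma sum_prod_pow_le_two (hw : w ∈ stdSimplex ℝ V) (ha : ∀ i, 1 ≤ a i) {i j : ι} (hij : i ≠ j)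
    (p q : V) :
    ∑ σ : ι → V with σ i = p ∧ σ j = q, ∏ l, w (σ l) ^ a l ≤ w p ^ a i * w q ^ a j := by
  let S : ι → Finset V := fun l => if l = i then {p} else if l = j then {q} else Finset.univ
  have hS : (Finset.univ.filter fun σ : ι → V => σ i = p ∧ σ j = q) = Fintype.piFinset S := by
    ext σ
    simp only [Finset.mem_filter, Finset.mem_univ, true_and, Fintype.mem_piFinset, S]
    constructor
    · intro h l
      split_ifs with hl <;> simp [*]
    · intro h
      have h1 := h i
      have h2 := h j
      simp only [↓reduceIte, hij.symm, Finset.mem_singleton] at h1 h2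
      exact ⟨h1, h2⟩
  rw [hS, ← Finset.prod_univ_sum S (fun l v => w v ^ a l)]
  calc _ ≤ ∏ l, (if l = i then w p ^ a i else 1) * (if l = j then w q ^ a j else 1) := by
        refine Finset.prod_le_prod
          (fun l _ => Finset.sum_nonneg fun v _ => pow_nonneg (hw.1 v) _) fun l _ => ?_
        by_cases hl : l = i
        · have : l ≠ j := hl ▸ hij
          simp [S, hl, hij]
        · by_cases hl' : l = j
          · simp [S, hl', hij.symm]
          · simpa [S, hl, hl'] using sum_pow_le_one hw ha l
    _ = _ := by rw [Finset.prod_mul_distrib]; simp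

omit [Fintype V] in
/-- Lower bound for the contribution of an injection that hits `p` but not `q` after merging. -/
lemma prod_mergeWeight_ge (hw : ∀ v, 0 ≤ w v) (hpq : p ≠ q) (ha : ∀ i, 1 ≤ a i) {σ : ι → V}
    (hσ : Function.Injective σ) {i : ι} (hi : σ i = p) (hq : ∀ l, σ l ≠ q) :
    ∏ l, w (σ l) ^ a l + ∏ l, w (Equiv.swap p q (σ l)) ^ a l ≤
      ∏ l, mergeWeight w p q (σ l) ^ a l ∧
    (2 ≤ a i → ∏ l, w (σ l) ^ a l + ∏ l, w (Equiv.swap p q (σ l)) ^ a l +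
        (w p * w q ^ (a i - 1) + w p ^ (a i - 1) * w q) *
          ∏ l ∈ Finset.univ.erase i, w (σ l) ^ a l ≤
      ∏ l, mergeWeight w p q (σ l) ^ a l) := by
  have hp : ∀ l ∈ Finset.univ.erase i, σ l ≠ p := by
    intro l hl h
    exact (Finset.mem_erase.1 hl).1 (hσ (h.trans hi.symm))
  have h1 : ∏ l ∈ Finset.univ.erase i, w (Equiv.swap p q (σ l)) ^ a l =
      ∏ l ∈ Finset.univ.erase i, w (σ l) ^ a l :=
    Finset.prod_congr rfl fun l hl => by
      rw [Equiv.swap_apply_of_ne_of_ne (hp l hl) (hq l)]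
  have h2 : ∏ l ∈ Finset.univ.erase i, mergeWeight w p q (σ l) ^ a l =
      ∏ l ∈ Finset.univ.erase i, w (σ l) ^ a l :=
    Finset.prod_congr rfl fun l hl => by rw [mergeWeight_of_ne (hp l hl) (hq l)]
  have hR : 0 ≤ ∏ l ∈ Finset.univ.erase i, w (σ l) ^ a l :=
    Finset.prod_nonneg fun l _ => pow_nonneg (hw _) _
  rw [← Finset.mul_prod_erase _ _ (Finset.mem_univ i),
    ← Finset.mul_prod_erase _ (fun l => w (Equiv.swap p q (σ l)) ^ a l) (Finset.mem_univ i),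
    ← Finset.mul_prod_erase _ (fun l => mergeWeight w p q (σ l) ^ a l) (Finset.mem_univ i),
    h1, h2, hi, Equiv.swap_apply_left, mergeWeight_left hpq]
  refine ⟨?_, fun h2 => ?_⟩
  · rw [← add_mul]
    exact mul_le_mul_of_nonneg_right (pow_add_pow_le (hw p) (hw q)
        (Nat.one_le_iff_ne_zero.1 (ha i))) hR
  · rw [← add_mul, ← add_mul]
    refine mul_le_mul_of_nonneg_right ?_ hR
    obtain ⟨n, hn⟩ : ∃ n, a i = n + 1 := ⟨a i - 1, by omega⟩
    have h := pow_add_pow_le (hw p) (hw q) (n := n) (by omega)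
    rw [hn, Nat.add_sub_cancel, pow_succ (w p + w q)]
    have := mul_le_mul_of_nonneg_right h (add_nonneg (hw p) (hw q))
    rw [pow_succ, pow_succ]
    linarith

/-- The injections missing both `p` and `q` contribute at most as much as the ones
with `σ i = p` that miss `q`, deprived of their factor at `i`. -/
lemma sum_avoid_le (hw : w ∈ stdSimplex ℝ V) (ha : ∀ i, 1 ≤ a i) (hpq : p ≠ q) (i : ι) :
    ∑ σ : ι → V with Function.Injective σ ∧ (∀ l, σ l ≠ p) ∧ (∀ l, σ l ≠ q),
        ∏ l, w (σ l) ^ a l ≤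
      ∑ σ : ι → V with Function.Injective σ ∧ σ i = p ∧ (∀ l, σ l ≠ q),
        ∏ l ∈ Finset.univ.erase i, w (σ l) ^ a l := by
  rw [← mul_one (∑ σ : ι → V with Function.Injective σ ∧ σ i = p ∧ (∀ l, σ l ≠ q), _),
    ← hw.2, Finset.sum_mul_sum, ← Finset.sum_product']
  refine sum_le_sum_of_injOn_of_le (fun σ => (Function.update σ i p, σ i)) ?_ ?_ ?_ ?_
  · intro σ hσ
    simp only [Finset.mem_filter, Finset.mem_univ, true_and, Finset.mem_product, and_true] at hσ ⊢
    obtain ⟨hinj, hp, hq⟩ := hσ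
    refine ⟨?_, by simp, fun l => ?_⟩
    · intro x y hxy
      simp only [Function.update_apply] at hxy
      split_ifs at hxy with hx hy hy
      · rw [hx, hy]
      · exact absurd hxy.symm (hp y)
      · exact absurd hxy (hp x)
      · exact hinj hxy
    · rw [Function.update_apply]
      split_ifs
      · exact hpq
      · exact hq l
  · intro σ _ τ _ h
    rw [Prod.mk.injEq] at h
    ext l
    by_cases hl : l = i
    · rw [hl, h.2]
    · simpa [hl] using congrFun h.1 l
  · intro σ _
    have : ∏ l ∈ Finset.univ.erase i, w (Function.update σ i p l) ^ a l =
        ∏ l ∈ Finset.univ.erase i, w (σ l) ^ a l :=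
      Finset.prod_congr rfl fun l hl => by
        rw [Function.update_of_ne (Finset.mem_erase.1 hl).1]
    rw [this, ← Finset.mul_prod_erase _ _ (Finset.mem_univ i), mul_comm]
    exact mul_le_mul_of_nonneg_left
      (pow_le_of_le_one (hw.1 _) (mem_Icc_of_mem_stdSimplex hw _).2
          (Nat.one_le_iff_ne_zero.1 (ha i)))
      (Finset.prod_nonneg fun l _ => pow_nonneg (hw.1 _) _)
  · intro z _
    exact mul_nonneg (Finset.prod_nonneg fun l _ => pow_nonneg (hw.1 _) _) (hw.1 _)

omit [Fintype ι] [DecidableEq ι] [DecidableEq V] in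
/-- A monomial in which two small weights occupy different parts is negligible. -/
lemma pow_mul_pow_le (hw : w ∈ stdSimplex ℝ V) {ε : ℝ} (hp : w p ≤ ε) (hq : w q ≤ ε) {i₀ i j : ι}
    (h2 : 2 ≤ a i₀) (ha : ∀ i, 1 ≤ a i) (hij : a i₀ ≤ a i ∨ a i₀ ≤ a j) :
    w p ^ a i * w q ^ a j ≤ ε * (w p * w q ^ (a i₀ - 1) + w p ^ (a i₀ - 1) * w q) := by
  have hp0 := hw.1 p
  have hq0 := hw.1 q
  have hp1 := (mem_Icc_of_mem_stdSimplex hw p).2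
  have hq1 := (mem_Icc_of_mem_stdSimplex hw q).2
  have hε : 0 ≤ ε := hp0.trans hp
  have key : ∀ {x : ℝ} {k : ℕ}, 0 ≤ x → x ≤ 1 → x ≤ ε → a i₀ ≤ k →
      x ^ k ≤ ε * x ^ (a i₀ - 1) := by
    intro x k hx hx1 hxe hk
    calc x ^ k ≤ x ^ a i₀ := pow_le_pow_of_le_one hx hx1 hk
      _ = x * x ^ (a i₀ - 1) := by rw [← pow_succ']; congr 1; omega
      _ ≤ _ := mul_le_mul_of_nonneg_right hxe (pow_nonneg hx _)
  have hA : 0 ≤ ε * (w p * w q ^ (a i₀ - 1)) := by positivity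
  have hB : 0 ≤ ε * (w p ^ (a i₀ - 1) * w q) := by positivity
  rcases hij with h | h
  · have := mul_le_mul (key hp0 hp1 hp h) (pow_le_of_le_one hq0 hq1
      (Nat.one_le_iff_ne_zero.1 (ha j)))
      (pow_nonneg hq0 _) (by positivity)
    linarith
  · have := mul_le_mul (pow_le_of_le_one hp0 hp1
      (Nat.one_le_iff_ne_zero.1 (ha i))) (key hq0 hq1 hq h)
      (pow_nonneg hq0 _) hp0
    linarith

/-- Merging two small weights does not decrease an injection sum that is not small. -/
lemma injSum_le_mergeWeight (hw : w ∈ stdSimplex ℝ V) (hpq : p ≠ q) {i₀ : ι} (h2 : 2 ≤ a i₀)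
    (ha : ∀ i, 1 ≤ a i) (hij : ∀ i j, i ≠ j → a i₀ ≤ a i ∨ a i₀ ≤ a j) {ε : ℝ} (hp : w p ≤ ε)
    (hq : w q ≤ ε)
    (hc : ((Fintype.card ι : ℝ) ^ 2 + 2 * Fintype.card ι) * ε ≤ injSum a w) :
    injSum a w ≤ injSum a (mergeWeight w p q) := by
  classical
  set B := w p * w q ^ (a i₀ - 1) + w p ^ (a i₀ - 1) * w q with hB
  have hp0 := hw.1 p
  have hq0 := hw.1 q
  have hε : 0 ≤ ε := hp0.trans hp
  have hB0 : 0 ≤ B := by positivity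
  have hW : ∀ σ : ι → V, 0 ≤ ∏ l, w (σ l) ^ a l :=
    fun σ => Finset.prod_nonneg fun l _ => pow_nonneg (hw.1 _) _
  let J : Finset (ι → V) := Finset.univ.filter Function.Injective
  let J₀₀ := J.filter fun σ => (∀ l, σ l ≠ p) ∧ ∀ l, σ l ≠ q
  let J₁₀ := J.filter fun σ => (∃ l, σ l = p) ∧ ∀ l, σ l ≠ q
  let J₀₁ := J.filter fun σ => (∀ l, σ l ≠ p) ∧ ∃ l, σ l = q
  let J₁₁ := J.filter fun σ => (∃ l, σ l = p) ∧ ∃ l, σ l = q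
  have split : ∀ f : (ι → V) → ℝ, ∑ σ ∈ J, f σ =
      ∑ σ ∈ J₀₀, f σ + ∑ σ ∈ J₁₀, f σ + ∑ σ ∈ J₀₁, f σ + ∑ σ ∈ J₁₁, f σ := by
    intro f
    simp only [J₀₀, J₁₀, J₀₁, J₁₁, Finset.sum_filter _ f, ← Finset.sum_add_distrib]
    refine Finset.sum_congr rfl fun σ _ => ?_
    by_cases h1 : ∃ l, σ l = p <;> by_cases h2 : ∃ l, σ l = q
    · have h1' : ¬ ∀ l, σ l ≠ p := by push Not; exact h1
      have h2' : ¬ ∀ l, σ l ≠ q := by push Not; exact h2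
      simp only [h1, h2, h1', h2', and_true, and_false, if_true, if_false]; ring
    · have h1' : ¬ ∀ l, σ l ≠ p := by push Not; exact h1
      have h2' : ∀ l, σ l ≠ q := by push Not at h2; exact h2
      simp only [h1, h2, h1', iff_true_intro h2', and_true, and_false, if_true, if_false]; ring
    · have h1' : ∀ l, σ l ≠ p := by push Not at h1; exact h1
      have h2' : ¬ ∀ l, σ l ≠ q := by push Not; exact h2
      simp only [h1, h2, iff_true_intro h1', h2', and_true, and_false, if_true, if_false]; ring
    · have h1' : ∀ l, σ l ≠ p := by push Not at h1; exact h1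
      have h2' : ∀ l, σ l ≠ q := by push Not at h2; exact h2
      simp only [h1, h2, iff_true_intro h1', iff_true_intro h2', and_true, and_false, if_true,
        if_false]; ring
  set E := ∑ σ : ι → V with Function.Injective σ ∧ σ i₀ = p ∧ (∀ l, σ l ≠ q),
    ∏ l ∈ Finset.univ.erase i₀, w (σ l) ^ a l with hE
  have h00 : ∑ σ ∈ J₀₀, ∏ l, w (σ l) ^ a l ≤ E := by
    refine le_of_eq_of_le ?_ (sum_avoid_le hw ha hpq i₀)
    simp only [J₀₀, J, Finset.filter_filter]
  have hone : ∀ v, w v ≤ ε → ∑ i : ι, ∑ σ : ι → V with σ i = v, ∏ l, w (σ l) ^ a l ≤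
      Fintype.card ι * ε := by
    intro v hv
    rw [← nsmul_eq_mul]
    refine Finset.sum_le_card_nsmul _ _ _ fun i _ => (sum_prod_pow_le hw ha i v).trans ?_
    exact (pow_le_of_le_one (hw.1 v) (mem_Icc_of_mem_stdSimplex hw v).2
        (Nat.one_le_iff_ne_zero.1 (ha i))).trans hv
  have hP : ∑ σ ∈ J₁₀, ∏ l, w (σ l) ^ a l + ∑ σ ∈ J₁₁, ∏ l, w (σ l) ^ a l ≤
      Fintype.card ι * ε := by
    refine le_trans ?_ (hone p hp)
    rw [← Finset.sum_union]
    · refine sum_le_sum_sum_of_cover (fun i (σ : ι → V) => σ i = p) (Finset.subset_univ _)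
        (fun σ _ => hW σ) ?_
      intro σ hσ
      simp only [J₁₀, J₁₁, Finset.mem_union, Finset.mem_filter] at hσ
      simp only [Finset.mem_univ, true_and]
      tauto
    · rw [Finset.disjoint_left]
      intro σ h h'
      simp only [J₁₀, J₁₁, Finset.mem_filter] at h h'
      exact h'.2.2.elim fun l hl => h.2.2 l hl
  have hQ : ∑ σ ∈ J₀₁, ∏ l, w (σ l) ^ a l ≤ Fintype.card ι * ε := by
    refine le_trans ?_ (hone q hq)
    refine sum_le_sum_sum_of_cover (fun i (σ : ι → V) => σ i = q) (Finset.subset_univ _)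
      (fun σ _ => hW σ) ?_
    intro σ hσ
    simp only [J₀₁, Finset.mem_filter] at hσ
    simpa using hσ.2.2
  have hloss : ∑ σ ∈ J₁₁, ∏ l, w (σ l) ^ a l ≤ (Fintype.card ι : ℝ) ^ 2 * (ε * B) := by
    calc _ ≤ ∑ z ∈ (Finset.univ : Finset ι).offDiag,
          ∑ σ : ι → V with σ z.1 = p ∧ σ z.2 = q, ∏ l, w (σ l) ^ a l := by
          refine sum_le_sum_sum_of_cover (fun (z : ι × ι) (σ : ι → V) => σ z.1 = p ∧ σ z.2 = q)
            (Finset.subset_univ _) (fun σ _ => hW σ) ?_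
          intro σ hσ
          simp only [J₁₁, Finset.mem_filter] at hσ
          obtain ⟨_, ⟨i, hi⟩, j, hj⟩ := hσ
          refine ⟨(i, j), ?_, hi, hj⟩
          simp only [Finset.mem_offDiag, Finset.mem_univ, true_and]
          rintro rfl
          exact hpq (hi.symm.trans hj)
      _ ≤ ((Finset.univ : Finset ι).offDiag.card : ℝ) * (ε * B) := by
          rw [← nsmul_eq_mul]
          refine Finset.sum_le_card_nsmul _ _ _ fun z hz => ?_
          have hz' : z.1 ≠ z.2 := (Finset.mem_offDiag.1 hz).2.2
          exact (sum_prod_pow_le_two hw ha hz' p q).trans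
            (pow_mul_pow_le hw hp hq h2 ha (hij _ _ hz'))
      _ ≤ _ := by
          refine mul_le_mul_of_nonneg_right ?_ (mul_nonneg hε hB0)
          rw [Finset.offDiag_card, Finset.card_univ]
          have : Fintype.card ι * Fintype.card ι - Fintype.card ι ≤ Fintype.card ι ^ 2 := by
            rw [sq]; exact Nat.sub_le _ _
          exact_mod_cast this
  have hM00 : ∑ σ ∈ J₀₀, ∏ l, mergeWeight w p q (σ l) ^ a l = ∑ σ ∈ J₀₀, ∏ l, w (σ l) ^ a l := by
    refine Finset.sum_congr rfl fun σ hσ => Finset.prod_congr rfl fun l _ => ?_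
    simp only [J₀₀, Finset.mem_filter] at hσ
    rw [mergeWeight_of_ne (hσ.2.1 l) (hσ.2.2 l)]
  have hMnn : ∀ s : Finset (ι → V), 0 ≤ ∑ σ ∈ s, ∏ l, mergeWeight w p q (σ l) ^ a l :=
    fun s => Finset.sum_nonneg fun σ _ => Finset.prod_nonneg fun l _ =>
      pow_nonneg (mergeWeight_nonneg hw.1 hpq _) _
  have hswap : ∑ σ ∈ J₀₁, ∏ l, w (σ l) ^ a l ≤
      ∑ σ ∈ J₁₀, ∏ l, w (Equiv.swap p q (σ l)) ^ a l := by
    refine sum_le_sum_of_injOn_of_le (fun σ => Equiv.swap p q ∘ σ) ?_ ?_ ?_ ?_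
    · intro σ hσ
      simp only [J₀₁, J₁₀, J, Finset.mem_filter, Finset.mem_univ, true_and] at hσ ⊢
      obtain ⟨hinj, hp', l, hl⟩ := hσ
      refine ⟨(Equiv.swap p q).injective.comp hinj, ⟨l, by simp [hl]⟩, fun l h => ?_⟩
      have := congrArg (Equiv.swap p q) h
      simp only [Function.comp_apply, Equiv.swap_apply_self, Equiv.swap_apply_right] at this
      exact hp' l this
    · intro σ _ τ _ h
      exact (Equiv.swap p q).injective.comp_left h
    · intro σ _
      simp
    · intro σ _
      exact hW fun l => Equiv.swap p q (σ l)
  have hgain : ∑ σ ∈ J₁₀, ∏ l, w (σ l) ^ a l + ∑ σ ∈ J₁₀, ∏ l, w (Equiv.swap p q (σ l)) ^ a l +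
      B * E ≤ ∑ σ ∈ J₁₀, ∏ l, mergeWeight w p q (σ l) ^ a l := by
    have hE' : B * E = ∑ σ ∈ J₁₀,
        if σ i₀ = p then B * ∏ l ∈ Finset.univ.erase i₀, w (σ l) ^ a l else 0 := by
      rw [hE, Finset.mul_sum, ← Finset.sum_filter]
      refine Finset.sum_congr ?_ fun _ _ => rfl
      ext σ
      simp only [J₁₀, J, Finset.mem_filter, Finset.mem_univ, true_and]
      constructor
      · rintro ⟨h1, h2, h3⟩
        exact ⟨⟨h1, ⟨i₀, h2⟩, h3⟩, h2⟩
      · rintro ⟨⟨h1, _, h3⟩, h2⟩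
        exact ⟨h1, h2, h3⟩
    rw [hE', ← Finset.sum_add_distrib, ← Finset.sum_add_distrib]
    refine Finset.sum_le_sum fun σ hσ => ?_
    simp only [J₁₀, J, Finset.mem_filter, Finset.mem_univ, true_and] at hσ
    obtain ⟨hinj, ⟨i, hi⟩, hq'⟩ := hσ
    split_ifs with h0
    · exact (prod_mergeWeight_ge hw.1 hpq ha hinj h0 hq').2 h2
    · rw [add_zero]
      exact (prod_mergeWeight_ge hw.1 hpq ha hinj hi hq').1
  have hw' : injSum a w = ∑ σ ∈ J, ∏ l, w (σ l) ^ a l := by simp only [injSum, J]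
  have hm' : injSum a (mergeWeight w p q) = ∑ σ ∈ J, ∏ l, mergeWeight w p q (σ l) ^ a l := by
    simp only [injSum, J]
  rw [split] at hw' hm'
  have hEge : (Fintype.card ι : ℝ) ^ 2 * ε ≤ E := by linarith
  have := mul_le_mul_of_nonneg_left hEge hB0
  linarith [hMnn J₀₁, hMnn J₁₁]

/-- A weight with at most `t` nonzero values can be transported to `t` points. -/
lemma exists_injSum_le_fin (hw : w ∈ stdSimplex ℝ V) (ha : ∀ i, 1 ≤ a i) {t : ℕ} (ht : 0 < t)
    (hcard : (Finset.univ.filter fun v => w v ≠ 0).card ≤ t) :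
    ∃ y ∈ stdSimplex ℝ (Fin t), injSum a w ≤ injSum a y := by
  classical
  have : Nonempty (Fin t) := ⟨⟨0, ht⟩⟩
  obtain ⟨e, -, he⟩ := (Finset.univ.filter fun v => w v ≠ 0).finite_toSet.exists_injOn_of_encard_le
    (t := (Set.univ : Set (Fin t))) (by
      rw [Set.encard_coe_eq_coe_finsetCard, Set.encard_univ]
      simpa using hcard)
  let y : Fin t → ℝ := fun j => ∑ v with e v = j, w v
  have hy0 : ∀ j, 0 ≤ y j := fun j => Finset.sum_nonneg fun v _ => hw.1 v
  refine ⟨y, ⟨hy0, ?_⟩, ?_⟩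
  · rw [Finset.sum_fiberwise, hw.2]
  have hy : ∀ v, w v ≤ y (e v) := fun v =>
    Finset.single_le_sum (f := w) (fun v _ => hw.1 v) (by simp)
  have hsum : injSum a w = ∑ σ : ι → V with Function.Injective σ ∧ ∀ l, w (σ l) ≠ 0,
      ∏ l, w (σ l) ^ a l := by
    rw [injSum, ← Finset.filter_filter]
    refine (Finset.sum_filter_of_ne fun σ _ h l h0 => ?_).symm
    exact h (Finset.prod_eq_zero (Finset.mem_univ l) (by rw [h0, zero_pow
        (Nat.one_le_iff_ne_zero.1 (ha l))]))
  rw [hsum, injSum]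
  refine sum_le_sum_of_injOn_of_le (fun σ => e ∘ σ) ?_ ?_ ?_ ?_
  · intro σ hσ
    simp only [Finset.mem_filter, Finset.mem_univ, true_and] at hσ ⊢
    intro x y hxy
    exact hσ.1 (he (by simpa using hσ.2 x) (by simpa using hσ.2 y) hxy)
  · intro σ hσ τ hτ h
    simp only [Finset.coe_filter, Finset.mem_univ, true_and, Set.mem_ofPred_eq] at hσ hτ
    ext l
    exact he (by simpa using hσ.2 l) (by simpa using hτ.2 l) (congrFun h l)
  · intro σ _
    exact Finset.prod_le_prod (fun l _ => pow_nonneg (hw.1 _) _) fun l _ =>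
      pow_le_pow_left₀ (hw.1 _) (hy _) _
  · intro σ _
    exact Finset.prod_nonneg fun l _ => pow_nonneg (hy0 _) _

end InjSum

/-- The injection sum over weights on arbitrarily many points is bounded by its values
for weights on a fixed number of points. -/
lemma exists_injSum_le_of_stdSimplex {ι : Type*} [Fintype ι] [DecidableEq ι] [Nonempty ι]
    {a : ι → ℕ} {i₀ : ι} (h2 : 2 ≤ a i₀) (ha : ∀ i, 1 ≤ a i)
    (hij : ∀ i j, i ≠ j → a i₀ ≤ a i ∨ a i₀ ≤ a j) :
    ∃ t : ℕ, Fintype.card ι ≤ t ∧ ∀ (n : ℕ), ∀ w ∈ stdSimplex ℝ (Fin n),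
      ∃ y ∈ stdSimplex ℝ (Fin t), injSum a w ≤ injSum a y := by
  classical
  have hr : (0 : ℝ) < Fintype.card ι := by exact_mod_cast Fintype.card_pos
  let u : ι → ℝ := fun _ => (Fintype.card ι : ℝ)⁻¹
  have hu : u ∈ stdSimplex ℝ ι := by
    refine ⟨fun _ => by positivity, ?_⟩
    simp [u, hr.ne']
  set c := injSum a u with hc
  have hc0 : 0 < c := by
    rw [hc, injSum]
    refine Finset.sum_pos (fun σ _ => Finset.prod_pos fun l _ => by positivity) ⟨id, ?_⟩
    simpa using Function.injective_id
  set K : ℝ := (Fintype.card ι : ℝ) ^ 2 + 2 * Fintype.card ι with hK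
  have hK0 : 0 < K := by positivity
  set ε := c / K with hε
  have hε0 : 0 < ε := div_pos hc0 hK0
  have hKε : K * ε = c := mul_div_cancel₀ _ hK0.ne'
  obtain ⟨N, hN⟩ := exists_nat_gt (1 / ε)
  have hNε : 1 < N * ε := (div_lt_iff₀ hε0).1 hN
  refine ⟨max (Fintype.card ι) (N + 1), le_max_left _ _, fun n w hw => ?_⟩
  set t := max (Fintype.card ι) (N + 1)
  have ht : 0 < t := Nat.lt_of_lt_of_le Nat.succ_pos' (le_max_right _ _)
  by_cases hwc : injSum a w ≤ c
  · obtain ⟨y, hy, hle⟩ := exists_injSum_le_fin hu ha ht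
      ((Finset.card_le_univ _).trans (le_max_left _ _))
    exact ⟨y, hy, hwc.trans hle⟩
  push Not at hwc
  induction hm : (Finset.univ.filter fun v => w v ≠ 0).card using Nat.strong_induction_on
    generalizing w with
  | _ m ih =>
  by_cases hmt : m ≤ t
  · exact exists_injSum_le_fin hw ha ht (hm ▸ hmt)
  push Not at hmt
  set S := Finset.univ.filter fun v => w v ≠ 0
  have hbig : (S.filter fun v => ¬ w v ≤ ε).card ≤ N := by
    by_contra hcon
    rw [not_le] at hcon
    have h1 : ((S.filter fun v => ¬ w v ≤ ε).card : ℝ) * ε ≤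
        ∑ v ∈ S.filter fun v => ¬ w v ≤ ε, w v := by
      rw [← nsmul_eq_mul]
      refine Finset.card_nsmul_le_sum _ _ _ fun v hv => ?_
      exact (not_le.1 (Finset.mem_filter.1 hv).2).le
    have h2 : ∑ v ∈ S.filter (fun v => ¬ w v ≤ ε), w v ≤ 1 := by
      rw [← hw.2]
      exact Finset.sum_le_sum_of_subset_of_nonneg (Finset.subset_univ _) fun v _ _ => hw.1 v
    have h3 : (N : ℝ) * ε ≤ ((S.filter fun v => ¬ w v ≤ ε).card : ℝ) * ε :=
      mul_le_mul_of_nonneg_right (by exact_mod_cast hcon.le) hε0.le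
    linarith
  have hsmall : 1 < (S.filter fun v => w v ≤ ε).card := by
    have := Finset.card_filter_add_card_filter_not (s := S) (fun v => w v ≤ ε)
    have ht' : N + 1 ≤ t := le_max_right _ _
    omega
  obtain ⟨p, hp, q, hq, hpq⟩ := Finset.one_lt_card.1 hsmall
  simp only [S, Finset.mem_filter, Finset.mem_univ, true_and] at hp hq
  have hle := injSum_le_mergeWeight hw hpq h2 ha hij hp.2 hq.2 (by rw [← hK, hKε]; exact hwc.le)
  obtain ⟨y, hy, hle'⟩ := ih _ (hm ▸ card_support_mergeWeight_lt hpq hp.1 hq.1) _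
    (mergeWeight_mem_stdSimplex hw hpq) (hwc.trans_le hle) rfl
  exact ⟨y, hy, hle.trans hle'⟩

section Counting

lemma natCard_embedding_eq_mul_inducedCount {α β : Type*} [Fintype α] [Fintype β]
    (F : SimpleGraph α) (G : SimpleGraph β) :
    Nat.card (F ↪g G) = Nat.card (F ≃g F) * inducedCount F G := by
  classical
  let S : Set (Finset β) := {s : Finset β | s.card = Fintype.card α ∧
    Nonempty (F ≃g SimpleGraph.induce (↑s : Set β) G)}
  have hS : inducedCount F G = Nat.card S := (Nat.card_coe_set_eq S).symm
  rw [hS, ← Nat.card_prod]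
  let e : ∀ s : S, F ≃g SimpleGraph.induce (↑(s : Finset β) : Set β) G := fun s => s.2.2.some
  let Φ : (F ≃g F) × S → (F ↪g G) := fun z =>
    (SimpleGraph.Embedding.induce _).comp (((e z.2).toEmbedding).comp z.1.toEmbedding)
  have hΦ : ∀ z x, Φ z x = e z.2 (z.1 x) := fun z x => rfl
  have hrange : ∀ z, Set.range (Φ z) = ((z.2 : Finset β) : Set β) := by
    intro z
    ext b
    constructor
    · rintro ⟨x, rfl⟩
      rw [hΦ]
      exact (e z.2 (z.1 x)).2
    · intro hb
      refine ⟨z.1.symm ((e z.2).symm ⟨b, hb⟩), ?_⟩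
      rw [hΦ]
      simp
  refine (Nat.card_eq_of_bijective Φ ⟨?_, ?_⟩).symm
  · rintro ⟨φ, s⟩ ⟨ψ, s'⟩ h
    have hs : s = s' := by
      have := (hrange ⟨φ, s⟩).symm.trans ((congrArg (fun f : F ↪g G => Set.range f) h).trans
        (hrange ⟨ψ, s'⟩))
      exact Subtype.ext (Finset.coe_injective this)
    subst hs
    congr 1
    ext x
    have := DFunLike.congr_fun h x
    rw [hΦ, hΦ] at this
    exact (e s).injective (Subtype.ext this)
  · intro f
    let s : Finset β := Finset.univ.map f.toEmbedding
    have hs : (s : Set β) = Set.range f := by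
      ext b
      simp [s]
    let ef : F ≃g SimpleGraph.induce (↑s : Set β) G :=
      { toEquiv := (Equiv.ofInjective f f.injective).trans (Equiv.setCongr hs.symm)
        map_rel_iff' := by
          intro x y
          exact f.map_rel_iff }
    have hef : ∀ x, (ef x : β) = f x := fun x => rfl
    have hmem : s ∈ S := ⟨by simp [s], ⟨ef⟩⟩
    refine ⟨(ef.trans (e ⟨s, hmem⟩).symm, ⟨s, hmem⟩), ?_⟩
    ext x
    rw [hΦ, ← hef]
    simp

open Classical in
lemma natCard_embedding_eq_sum {α β : Type*} [Fintype α] [Fintype β] (F : SimpleGraph α)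
    (G : SimpleGraph β) :
    (Nat.card (F ↪g G) : ℝ) = ∑ e : α ↪ β, if G.comap e = F then 1 else 0 := by
  rw [Finset.sum_boole, ← Fintype.card_subtype, ← Nat.card_eq_fintype_card]
  congr 1
  refine Nat.card_congr
    { toFun := fun f => ⟨f.toEmbedding, by ext u v; exact f.map_rel_iff⟩
      invFun := fun e => ⟨e.1, by
        intro u v
        exact Iff.of_eq (congrArg (fun H : SimpleGraph α => H.Adj u v) e.2)⟩
      left_inv := fun f => rfl
      right_inv := fun e => rfl }

lemma natCard_embedding_le {α β : Type*} [Fintype α] [Fintype β] [Nonempty β] (F : SimpleGraph α)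
    (G : SimpleGraph β) :
    (Nat.card (F ↪g G) : ℝ) ≤ (Fintype.card β : ℝ) ^ Fintype.card α *
      patternSum F G fun _ => (Fintype.card β : ℝ)⁻¹ := by
  classical
  have hβ : (Fintype.card β : ℝ) ≠ 0 := by exact_mod_cast Fintype.card_ne_zero
  rw [natCard_embedding_eq_sum, patternSum, Finset.mul_sum]
  refine sum_le_sum_of_injOn_of_le (fun e => (e : α → β)) (fun _ _ => Finset.mem_univ _)
    (fun e _ e' _ h => DFunLike.coe_injective h) ?_ ?_
  · intro e _
    split_ifs
    · rw [Finset.prod_const, Finset.card_univ, ← mul_pow, mul_inv_cancel₀ hβ, one_pow]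
    · simp
  · intro f _
    split_ifs
    · positivity
    · simp

/-- The marginal of a product weight along an injection. -/
lemma sum_prod_filter_comp_embedding {α β V : Type*} [Fintype α] [Fintype β] [Fintype V]
    [DecidableEq β] [DecidableEq V] {w : V → ℝ} (hw : ∑ v, w v = 1) (e : α ↪ β) (f : α → V) :
    ∑ g : β → V with g ∘ e = f, ∏ b, w (g b) = ∏ x, w (f x) := by
  classical
  let S : β → Finset V := fun b => Finset.univ.filter fun v => ∀ x, e x = b → f x = v
  have hS : (Finset.univ.filter fun g : β → V => g ∘ e = f) = Fintype.piFinset S := by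
    ext g
    simp only [Finset.mem_filter, Finset.mem_univ, true_and, Fintype.mem_piFinset, S]
    constructor
    · rintro rfl _ x rfl
      rfl
    · intro h
      ext x
      exact (h (e x) x rfl).symm
  rw [hS, ← Finset.prod_univ_sum S (fun _ v => w v)]
  calc ∏ b, ∑ v ∈ S b, w v = ∏ b ∈ Finset.univ.map e, ∑ v ∈ S b, w v := by
        refine (Finset.prod_subset (Finset.subset_univ _) fun b _ hb => ?_).symm
        have : S b = Finset.univ := by
          ext v
          simp only [S, Finset.mem_filter, Finset.mem_univ, true_and, iff_true]
          intro x hx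
          exact absurd (Finset.mem_map.2 ⟨x, Finset.mem_univ _, hx⟩) hb
        rw [this, hw]
    _ = ∏ x, ∑ v ∈ S (e x), w v := Finset.prod_map _ _ _
    _ = _ := by
        refine Finset.prod_congr rfl fun x _ => ?_
        have : S (e x) = {f x} := by
          ext v
          simp only [S, Finset.mem_filter, Finset.mem_univ, true_and, Finset.mem_singleton]
          constructor
          · intro h
            exact (h x rfl).symm
          · rintro rfl y hy
            rw [e.injective hy]
        rw [this, Finset.sum_singleton]

/-- The pattern sum over `H` is the average embedding density in random pullbacks of `H`. -/
lemma sum_prod_mul_natCard_embedding {α β V : Type*} [Fintype α] [Fintype β] [DecidableEq β]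
    [Fintype V] (F : SimpleGraph α) (H : SimpleGraph V) {w : V → ℝ} (hw : ∑ v, w v = 1) :
    ∑ g : β → V, (∏ b, w (g b)) * Nat.card (F ↪g H.comap g) =
      (Fintype.card β).descFactorial (Fintype.card α) * patternSum F H w := by
  classical
  simp_rw [natCard_embedding_eq_sum, Finset.mul_sum]
  rw [Finset.sum_comm]
  have key : ∀ e : α ↪ β, ∑ g : β → V, (∏ b, w (g b)) *
      (if (H.comap g).comap e = F then (1 : ℝ) else 0) = patternSum F H w := by
    intro e
    rw [← Finset.sum_fiberwise Finset.univ (fun g : β → V => g ∘ e), patternSum]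
    refine Finset.sum_congr rfl fun f _ => ?_
    have : ∑ g : β → V with g ∘ e = f, (∏ b, w (g b)) *
        (if (H.comap g).comap e = F then (1 : ℝ) else 0) =
        ∑ g : β → V with g ∘ e = f, (∏ b, w (g b)) * (if H.comap f = F then (1 : ℝ) else 0) := by
      refine Finset.sum_congr rfl fun g hg => ?_
      rw [SimpleGraph.comap_comap, (Finset.mem_filter.1 hg).2]
    rw [this, ← Finset.sum_mul, sum_prod_filter_comp_embedding hw]
    split_ifs <;> simp
  rw [Finset.sum_congr rfl fun e _ => key e, Finset.sum_const, Finset.card_univ,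
    Fintype.card_embedding_eq, nsmul_eq_mul]

lemma exists_comap_natCard_embedding_ge {α β V : Type*} [Fintype α] [Fintype β]
    [Fintype V] (F : SimpleGraph α) (H : SimpleGraph V) {w : V → ℝ} (hw : w ∈ stdSimplex ℝ V) :
    ∃ g : β → V, ((Fintype.card β).descFactorial (Fintype.card α) : ℝ) * patternSum F H w ≤
      Nat.card (F ↪g H.comap g) := by
  classical
  by_contra! hcon
  have hone : ∑ g : β → V, ∏ b, w (g b) = 1 := by
    rw [← Fintype.piFinset_univ, ← Finset.prod_univ_sum (fun _ => Finset.univ) (fun _ v => w v),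
      hw.2, Finset.prod_const_one]
  have hnn : ∀ g : β → V, 0 ≤ ∏ b, w (g b) := fun g => Finset.prod_nonneg fun b _ => hw.1 _
  obtain ⟨g, -, hg⟩ := Finset.exists_lt_of_sum_lt (f := fun _ : β → V => (0 : ℝ))
    (s := Finset.univ) (g := fun g : β → V => ∏ b, w (g b)) (by rw [hone]; simp)
  have := sum_prod_mul_natCard_embedding (β := β) F H hw.2
  have hlt : ∑ g : β → V, (∏ b, w (g b)) * (Nat.card (F ↪g H.comap g) : ℝ) <
      ∑ g : β → V, (∏ b, w (g b)) *
        (((Fintype.card β).descFactorial (Fintype.card α) : ℝ) * patternSum F H w) :=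
    Finset.sum_lt_sum (fun g _ => mul_le_mul_of_nonneg_left (hcon g).le (hnn g))
      ⟨g, Finset.mem_univ _, mul_lt_mul_of_pos_left (hcon g) hg⟩
  rw [← Finset.sum_mul, hone, one_mul, this] at hlt
  exact lt_irrefl _ hlt

end Counting

section CompleteMultipartite

open SimpleGraph

variable {ι : Type*} [Fintype ι] [DecidableEq ι] {a : ι → ℕ}

lemma patternSum_completeMultipartiteGraph_top {V : Type*} [Fintype V] [DecidableEq V]
    (ha : ∀ i, 1 ≤ a i) (w : V → ℝ) :
    patternSum (completeMultipartiteGraph fun i => Fin (a i)) ⊤ w = injSum a w := by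
  classical
  rw [patternSum, injSum, ← Finset.sum_filter]
  symm
  refine Finset.sum_bij' (fun σ _ u => σ u.1) (fun f _ i => f ⟨i, ⟨0, ha i⟩⟩) ?_ ?_ ?_ ?_ ?_
  · intro σ hσ
    simp only [Finset.mem_filter, Finset.mem_univ, true_and] at hσ ⊢
    ext u v
    simp [hσ.eq_iff]
  · intro f hf
    simp only [Finset.mem_filter, Finset.mem_univ, true_and] at hf ⊢
    intro i j hij
    by_contra hne
    have : (completeMultipartiteGraph fun i => Fin (a i)).Adj ⟨i, ⟨0, ha i⟩⟩ ⟨j, ⟨0, ha j⟩⟩ := hne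
    rw [← hf] at this
    exact this hij
  · intro σ _
    rfl
  · intro f hf
    simp only [Finset.mem_filter, Finset.mem_univ, true_and] at hf
    ext u
    by_contra hne
    have : ((⊤ : SimpleGraph V).comap f).Adj ⟨u.1, ⟨0, ha u.1⟩⟩ u := hne
    rw [hf] at this
    exact this rfl
  · intro σ _
    rw [Fintype.prod_sigma]
    simp

/-- The automorphism of a complete multipartite graph that permutes the parts by `τ` and the
vertices inside them by `ρ`. -/
def completeMultipartiteAut (z : {τ : Equiv.Perm ι // a ∘ τ = a} × ∀ i, Equiv.Perm (Fin (a i))) :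
    completeMultipartiteGraph (fun i => Fin (a i)) ≃g
      completeMultipartiteGraph (fun i => Fin (a i)) where
  toEquiv := Equiv.sigmaCongr z.1.1 fun i =>
    (z.2 i).trans (finCongr (congrFun z.1.2 i).symm)
  map_rel_iff' := by
    intro u v
    exact z.1.1.injective.ne_iff

omit [DecidableEq ι] in
lemma completeMultipartiteAut_bijective (ha : ∀ i, 1 ≤ a i) :
    Function.Bijective (completeMultipartiteAut (a := a)) := by
  constructor
  · rintro ⟨⟨τ, hτ⟩, ρ⟩ ⟨⟨τ', hτ'⟩, ρ'⟩ h
    have hx : ∀ (i : ι) (x : Fin (a i)),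
        (⟨τ i, finCongr (congrFun hτ i).symm (ρ i x)⟩ : Σ i, Fin (a i)) =
          ⟨τ' i, finCongr (congrFun hτ' i).symm (ρ' i x)⟩ := fun i x => DFunLike.congr_fun h ⟨i, x⟩
    have hττ : τ = τ' := by
      ext i
      exact congrArg Sigma.fst (hx i ⟨0, ha i⟩)
    subst hττ
    congr 1
    ext i x
    have := hx i x
    rw [Sigma.mk.injEq] at this
    have := eq_of_heq this.2
    simpa using congrArg Fin.val this
  · intro φ
    have hφ : ∀ u v, (φ u).1 = (φ v).1 ↔ u.1 = v.1 := by
      intro u v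
      have := φ.map_rel_iff (a := u) (b := v)
      simp only [comap_adj, top_adj] at this
      exact not_iff_not.1 this
    let τ₀ : ι → ι := fun i => (φ ⟨i, ⟨0, ha i⟩⟩).1
    have hτ₀ : Function.Injective τ₀ := fun i j hij => (hφ _ _).1 hij
    let τ : Equiv.Perm ι := Equiv.ofBijective τ₀ (Finite.injective_iff_bijective.1 hτ₀)
    have hτ : ∀ u, (φ u).1 = τ u.1 := fun u => (hφ u ⟨u.1, ⟨0, ha u.1⟩⟩).2 rfl
    have hmem : ∀ (i : ι) (u : Σ i, Fin (a i)), u.1 = i ↔ (φ.toEquiv u).1 = τ i := by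
      intro i u
      change _ ↔ (φ u).1 = _
      rw [hτ, τ.injective.eq_iff]
    let E : ∀ i, Fin (a i) ≃ Fin (a (τ i)) := fun i =>
      (Equiv.sigmaSubtype i).symm.trans
        ((φ.toEquiv.subtypeEquiv (hmem i)).trans (Equiv.sigmaSubtype (τ i)))
    have hE : ∀ i x, φ ⟨i, x⟩ = ⟨τ i, E i x⟩ := by
      intro i x
      have h : ∀ (j : ι) (s : {s : Σ i, Fin (a i) // s.1 = j}),
          s.1 = ⟨j, Equiv.sigmaSubtype j s⟩ := by
        rintro j ⟨s, rfl⟩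
        rfl
      exact h (τ i) ((φ.toEquiv.subtypeEquiv (hmem i)) ((Equiv.sigmaSubtype i).symm x))
    have hcard : ∀ i, a i = a (τ i) := fun i => by
      simpa using Fintype.card_congr (E i)
    refine ⟨(⟨τ, funext fun i => (hcard i).symm⟩,
      fun i => (E i).trans (finCongr (hcard i).symm)), ?_⟩
    ext1 ⟨i, x⟩
    rw [hE]
    change (⟨τ i, _⟩ : Σ i, Fin (a i)) = _
    congr 1

lemma natCard_completeMultipartiteAut (ha : ∀ i, 1 ≤ a i) :
    Nat.card (completeMultipartiteGraph (fun i => Fin (a i)) ≃g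
      completeMultipartiteGraph (fun i => Fin (a i))) =
      (∏ i, (a i).factorial) * ∏ n ∈ Finset.range ((∑ i, a i) + 1),
        (Finset.univ.filter fun i => a i = n).card.factorial := by
  rw [← Nat.card_eq_of_bijective _ (completeMultipartiteAut_bijective ha), Nat.card_prod,
    Nat.card_eq_fintype_card, Nat.card_eq_fintype_card, DomMulAct.stabilizer_card', mul_comm]
  congr 1
  · rw [Fintype.card_pi]
    simp [Fintype.card_perm]
  · simp_rw [Fintype.card_subtype]
    refine Finset.prod_subset ?_ ?_
    · intro n hn
      obtain ⟨i, -, rfl⟩ := Finset.mem_image.1 hn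
      rw [Finset.mem_range, Nat.lt_succ_iff]
      exact Finset.single_le_sum (fun _ _ => Nat.zero_le _) (Finset.mem_univ i)
    · intro n _ hn
      rw [Finset.filter_false_of_mem, Finset.card_empty, Nat.factorial_zero]
      rintro i - rfl
      exact hn (Finset.mem_image_of_mem _ (Finset.mem_univ i))

end CompleteMultipartite

section Density

open SimpleGraph

lemma inducedDensity_eq {α β : Type*} [Fintype α] [Fintype β] (F : SimpleGraph α)
    (G : SimpleGraph β) :
    inducedDensity F G = ((Fintype.card α).factorial : ℝ) / Nat.card (F ≃g F) *
      (Nat.card (F ↪g G) / (Fintype.card β).descFactorial (Fintype.card α)) := by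
  have hA : (Nat.card (F ≃g F) : ℝ) ≠ 0 := by
    have : Finite (F ≃g F) := Finite.of_injective _ (DFunLike.coe_injective (F := F ≃g F))
    exact_mod_cast Nat.card_pos.ne'
  have hs : ((Fintype.card α).factorial : ℝ) ≠ 0 := by exact_mod_cast Nat.factorial_ne_zero _
  rw [inducedDensity, natCard_embedding_eq_mul_inducedCount,
    Nat.descFactorial_eq_factorial_mul_choose]
  push_cast
  rw [div_mul_div_comm, mul_left_comm, mul_div_mul_left _ _ hA, mul_div_mul_left _ _ hs]

lemma PF_eq_mul_injSum {r : ℕ} {a : Fin r → ℕ} (ha : ∀ i, 1 ≤ a i) (m : ℕ) (x : Fin m → ℝ) :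
    PF a m x = ((∑ i, a i).factorial : ℝ) /
      Nat.card (completeMultipartiteGraph (fun i => Fin (a i)) ≃g
        completeMultipartiteGraph (fun i => Fin (a i))) * injSum a x := by
  rw [PF, natCard_completeMultipartiteAut ha, injSum]
  congr 1
  rw [Finset.sum_subtype (Finset.univ.filter fun σ : Fin r → Fin m => Function.Injective σ)
    (p := Function.Injective) (by simp)]
  exact Fintype.sum_equiv (Equiv.subtypeInjectiveEquivEmbedding (Fin r) (Fin m)).symm _ _
    fun σ => rfl

variable {r : ℕ} {a : Fin r → ℕ}

lemma continuous_PF (a : Fin r → ℕ) (m : ℕ) : Continuous (PF a m) := by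
  unfold PF
  fun_prop

lemma inducedDensity_completeMultipartiteGraph_le (ha : ∀ i, 1 ≤ a i) {t : ℕ} {M : ℝ}
    (ht : ∀ n, ∀ w ∈ stdSimplex ℝ (Fin n), ∃ y ∈ stdSimplex ℝ (Fin t), injSum a w ≤ injSum a y)
    (hM : ∀ x ∈ stdSimplex ℝ (Fin t), PF a t x ≤ M) {n : ℕ} (hn : n ≠ 0)
    (G : SimpleGraph (Fin n)) :
    inducedDensity (completeMultipartiteGraph fun i => Fin (a i)) G ≤
      (n : ℝ) ^ (∑ i, a i) / n.descFactorial (∑ i, a i) * M := by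
  have : Nonempty (Fin n) := Fin.pos_iff_nonempty.1 (Nat.pos_of_ne_zero hn)
  have hs : Fintype.card (Σ i, Fin (a i)) = ∑ i, a i := by simp
  have hn' : (n : ℝ) ≠ 0 := by exact_mod_cast hn
  obtain ⟨w, hw, hGw⟩ := exists_patternSum_le_top
    (completeMultipartiteGraph.isCompleteMultipartite fun i => Fin (a i)) G
    (w := fun _ => (n : ℝ)⁻¹) ⟨fun _ => by positivity, by simp [hn']⟩
  rw [patternSum_completeMultipartiteGraph_top ha] at hGw
  obtain ⟨y, hy, hwy⟩ := ht n w hw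
  have hemb := natCard_embedding_le (completeMultipartiteGraph fun i => Fin (a i)) G
  rw [hs, Fintype.card_fin] at hemb
  have hPF := hM y hy
  rw [PF_eq_mul_injSum ha] at hPF
  rw [inducedDensity_eq, hs, Fintype.card_fin]
  set C : ℝ := ((∑ i, a i).factorial : ℝ) /
      Nat.card (completeMultipartiteGraph (fun i => Fin (a i)) ≃g
        completeMultipartiteGraph (fun i => Fin (a i)))
  have hC : 0 ≤ C := by positivity
  calc _ ≤ C * ((n : ℝ) ^ (∑ i, a i) * injSum a y / n.descFactorial (∑ i, a i)) := by
        gcongr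
        exact hemb.trans (mul_le_mul_of_nonneg_left (hGw.trans hwy) (by positivity))
    _ = (n : ℝ) ^ (∑ i, a i) / n.descFactorial (∑ i, a i) * (C * injSum a y) := by ring
    _ ≤ _ := by gcongr

lemma exists_cliqueFree_PF_le_inducedDensity (ha : ∀ i, 1 ≤ a i) {t k n : ℕ} (hk : t < k)
    (hn : ∑ i, a i ≤ n) {x : Fin t → ℝ} (hx : x ∈ stdSimplex ℝ (Fin t)) :
    ∃ G : SimpleGraph (Fin n), G.CliqueFree k ∧
      PF a t x ≤ inducedDensity (completeMultipartiteGraph fun i => Fin (a i)) G := by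
  have hs : Fintype.card (Σ i, Fin (a i)) = ∑ i, a i := by simp
  obtain ⟨g, hg⟩ := exists_comap_natCard_embedding_ge (β := Fin n)
    (completeMultipartiteGraph fun i => Fin (a i)) ⊤ hx
  refine ⟨(⊤ : SimpleGraph (Fin t)).comap g, ?_, ?_⟩
  · have hcol : ((⊤ : SimpleGraph (Fin t)).comap g).Colorable t :=
      ⟨Hom.comap g ⊤⟩
    exact hcol.cliqueFree hk
  · rw [hs, Fintype.card_fin, patternSum_completeMultipartiteGraph_top ha] at hg
    rw [inducedDensity_eq, PF_eq_mul_injSum ha, hs, Fintype.card_fin]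
    have hd : 0 < (n.descFactorial (∑ i, a i) : ℝ) := by
      exact_mod_cast Nat.descFactorial_pos.2 hn
    gcongr
    rwa [le_div_iff₀ hd, mul_comm]

lemma tendsto_pow_div_descFactorial (s : ℕ) :
    Tendsto (fun n : ℕ => (n : ℝ) ^ s / n.descFactorial s) atTop (𝓝 1) := by
  refine (Asymptotics.isEquivalent_iff_tendsto_one ?_).1 (isEquivalent_descFactorial s).symm
  filter_upwards [eventually_ge_atTop s] with n hn
  exact_mod_cast (Nat.descFactorial_pos.2 hn).ne'

/-- A density maximised over graph classes containing good pullbacks tends to the maximum of the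
density polynomial. -/
lemma tendsto_sSup_inducedDensity (ha : ∀ i, 1 ≤ a i) {t : ℕ} {x : Fin t → ℝ}
    (hx : x ∈ stdSimplex ℝ (Fin t))
    (ht : ∀ n, ∀ w ∈ stdSimplex ℝ (Fin n), ∃ y ∈ stdSimplex ℝ (Fin t), injSum a w ≤ injSum a y)
    (hM : ∀ y ∈ stdSimplex ℝ (Fin t), PF a t y ≤ PF a t x)
    (P : ∀ n, SimpleGraph (Fin n) → Prop)
    (hP : ∀ n, ∀ G : SimpleGraph (Fin n), G.CliqueFree (t + 1) → P n G) :
    Tendsto (fun n => sSup {z : ℝ | ∃ G : SimpleGraph (Fin n), P n G ∧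
      z = inducedDensity (completeMultipartiteGraph fun i => Fin (a i)) G}) atTop
      (𝓝 (PF a t x)) := by
  have ht0 : 0 < t := by
    rcases Nat.eq_zero_or_pos t with rfl | h
    · exact absurd hx.2 (by simp)
    · exact h
  have hlim := (tendsto_pow_div_descFactorial (∑ i, a i)).mul_const (PF a t x)
  rw [one_mul] at hlim
  refine tendsto_of_tendsto_of_tendsto_of_le_of_le' tendsto_const_nhds hlim ?_ ?_
  · filter_upwards [eventually_ge_atTop (∑ i, a i), eventually_ne_atTop 0] with n hn hn0
    obtain ⟨G, hG, hle⟩ := exists_cliqueFree_PF_le_inducedDensity ha (Nat.lt_succ_self t) hn hx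
    refine hle.trans (le_csSup
      ⟨(n : ℝ) ^ (∑ i, a i) / n.descFactorial (∑ i, a i) * PF a t x, ?_⟩ ⟨G, hP n G hG, rfl⟩)
    rintro _ ⟨G', -, rfl⟩
    exact inducedDensity_completeMultipartiteGraph_le ha ht hM hn0 G'
  · filter_upwards [eventually_ne_atTop 0] with n hn0
    refine csSup_le ⟨_, ⊥, hP n ⊥ (cliqueFree_bot (Nat.succ_le_succ ht0)), rfl⟩ ?_
    rintro _ ⟨G', -, rfl⟩
    exact inducedDensity_completeMultipartiteGraph_le ha ht hM hn0 G'

end Density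

/-- For a complete multipartite graph `F = K_{a_1,…,a_r}` with `a_1 ≥ … ≥ a_r ≥ 1`,
`r ≥ 2` and `a_{r-1} ≥ 2` (at most one singleton part), there is `t ≥ r` such that
`i_k(F) = i_{t+1}(F)` for all `k > t`; consequently
`i(F) = i_{t+1}(F) = max_{x ∈ Δ^{t-1}} P_{F,t}(x)` and `F` is not inducibility
diverse. -/
theorem stmt13 {r : ℕ} (hr : 2 ≤ r) (a : Fin r → ℕ) (ha : ∀ i, 1 ≤ a i)
    (hsorted : ∀ i j : Fin r, i ≤ j → a j ≤ a i)
    (h2 : ∀ i : Fin r, (i : ℕ) + 1 < r → 2 ≤ a i) :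
    ∃ t : ℕ, r ≤ t ∧
      (∀ k : ℕ, t < k →
        ik (SimpleGraph.completeMultipartiteGraph fun i => Fin (a i)) k =
          ik (SimpleGraph.completeMultipartiteGraph fun i => Fin (a i)) (t + 1)) ∧
      inducibility (SimpleGraph.completeMultipartiteGraph fun i => Fin (a i)) =
        ik (SimpleGraph.completeMultipartiteGraph fun i => Fin (a i)) (t + 1) ∧
      IsGreatest {v : ℝ | ∃ x ∈ stdSimplex ℝ (Fin t), v = PF a t x}
        (ik (SimpleGraph.completeMultipartiteGraph fun i => Fin (a i)) (t + 1)) ∧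
      ¬ InducibilityDiverse (SimpleGraph.completeMultipartiteGraph fun i => Fin (a i)) := by
  let i₀ : Fin r := ⟨r - 2, by omega⟩
  have : Nonempty (Fin r) := ⟨i₀⟩
  have hij : ∀ i j : Fin r, i ≠ j → a i₀ ≤ a i ∨ a i₀ ≤ a j := by
    intro i j hne
    have hv : (i : ℕ) ≠ j := fun h => hne (Fin.ext h)
    have hor : i ≤ i₀ ∨ j ≤ i₀ := by
      simp only [Fin.le_def, i₀]
      omega
    exact hor.imp (hsorted _ _) (hsorted _ _)
  obtain ⟨t, hrt, ht⟩ := exists_injSum_le_of_stdSimplex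
    (h2 i₀ (by simp only [i₀]; omega)) ha hij
  rw [Fintype.card_fin] at hrt
  have hne : (stdSimplex ℝ (Fin t)).Nonempty :=
    ⟨_, single_mem_stdSimplex ℝ (⟨0, by omega⟩ : Fin t)⟩
  obtain ⟨x, hx, hmax⟩ := (isCompact_stdSimplex ℝ (Fin t)).exists_isMaxOn hne
    (continuous_PF a t).continuousOn
  have hM : ∀ y ∈ stdSimplex ℝ (Fin t), PF a t y ≤ PF a t x := fun y hy => hmax hy
  have hik : ∀ k, t < k →
      ik (SimpleGraph.completeMultipartiteGraph fun i => Fin (a i)) k = PF a t x := fun k hk =>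
    (tendsto_sSup_inducedDensity ha hx ht hM (fun _ G => G.CliqueFree k)
      fun _ _ hG => hG.mono hk).limUnder_eq
  have hi : inducibility (SimpleGraph.completeMultipartiteGraph fun i => Fin (a i)) =
      PF a t x := by
    have h := tendsto_sSup_inducedDensity ha hx ht hM (fun _ _ => True) fun _ _ _ => trivial
    simp only [true_and] at h
    exact h.limUnder_eq
  refine ⟨t, hrt, fun k hk => ?_, ?_, ?_, fun hdiv => ?_⟩
  · rw [hik k hk, hik _ (Nat.lt_succ_self t)]
  · rw [hi, hik _ (Nat.lt_succ_self t)]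
  · rw [hik _ (Nat.lt_succ_self t)]
    refine ⟨⟨x, hx, rfl⟩, ?_⟩
    rintro _ ⟨y, hy, rfl⟩
    exact hM y hy
  · obtain ⟨m, hm, hlt⟩ := hdiv (t + 1)
    rw [hik _ (Nat.lt_succ_self t), hik m (by omega)] at hlt
    exact lt_irrefl _ hlt
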